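/- A matrix F ∈ GL(n,ℂ) is conjugate to its inverse if and only if for each eigenvalue λ ≠ ±1 and each block size m, the number of Jordan blocks of F of size m with eigenvalue λ equals the number of Jordan blocks of size m with eigenvalue λ⁻¹. -/

import Mathlib

/-- The number of Jordan blocks of `M` of size `m + 1` with eigenvalue `lam`, computed from
ranks: it equals `rank (M - lam)^m - 2 * rank (M - lam)^(m+1) + rank (M - lam)^(m+2)`. -/
noncomputable def jordanBlockCount {n : ℕ} (M : Matrix (Fin n) (Fin n) ℂ)
    (lam : ℂ) (m : ℕ) : ℤ :=
  (((M - lam • 1) ^ m).rank : ℤ) - 2 * (((M - lam • 1) ^ (m + 1)).rank : ℤ)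
    + (((M - lam • 1) ^ (m + 2)).rank : ℤ)

universe u

section
open Polynomial
variable {K : Type u} [Field K]

lemma finrank_torsionBy_congr {M N : Type*} [AddCommGroup M] [AddCommGroup N]
    [Module K M] [Module K N] [Module K[X] M] [Module K[X] N] [IsScalarTower K K[X] M]
    [IsScalarTower K K[X] N] (e : M ≃ₗ[K[X]] N) (p : K[X]) :
    Module.finrank K (Submodule.torsionBy K[X] M p) =
      Module.finrank K (Submodule.torsionBy K[X] N p) := by
  have h : (Submodule.torsionBy K[X] M p).map e.toLinearMap = Submodule.torsionBy K[X] N p := by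
    ext x
    simp only [Submodule.mem_map_equiv, Submodule.mem_torsionBy_iff]
    rw [← map_smul, EmbeddingLike.map_eq_zero_iff]
  exact (((e.submoduleMap _).trans (LinearEquiv.ofEq _ _ h)).restrictScalars K).finrank_eq

lemma finrank_torsionBy_pi {ι : Type*} [Fintype ι] {M : ι → Type*} [∀ i, AddCommGroup (M i)]
    [∀ i, Module K (M i)] [∀ i, Module K[X] (M i)] [∀ i, IsScalarTower K K[X] (M i)]
    [∀ i, FiniteDimensional K (M i)] (p : K[X]) :
    Module.finrank K (Submodule.torsionBy K[X] (∀ i, M i) p) =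
      ∑ i, Module.finrank K (Submodule.torsionBy K[X] (M i) p) := by
  have h (i) : FiniteDimensional K (Submodule.torsionBy K[X] (M i) p) :=
    inferInstanceAs (FiniteDimensional K ((Submodule.torsionBy K[X] (M i) p).restrictScalars K))
  rw [← Module.finrank_pi_fintype]
  let e : Submodule.torsionBy K[X] (∀ i, M i) p ≃ₗ[K] ∀ i, Submodule.torsionBy K[X] (M i) p :=
    { toFun x i := ⟨x.1 i, congrFun x.2 i⟩
      invFun y := ⟨fun i => (y i).1, funext fun i => (y i).2⟩
      map_add' _ _ := rfl
      map_smul' _ _ := rfl }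
  exact e.finrank_eq

lemma finrank_torsionBy_quotient_span {d p q : K[X]} (hpq : IsCoprime p q) (hd : d ≠ 0)
    (hq : q ≠ 0) :
    Module.finrank K (Submodule.torsionBy K[X] (K[X] ⧸ Ideal.span {d * q}) (d * p)) =
      d.natDegree := by
  let f : K[X] →ₗ[K[X]] K[X] ⧸ Ideal.span {d * q} :=
    (Submodule.mkQ (Ideal.span {d * q})) ∘ₗ LinearMap.mulLeft K[X] q
  have hf (x : K[X]) : f x = Ideal.Quotient.mk (Ideal.span {d * q}) (q * x) := rfl
  have hker : f.ker = Ideal.span {d} := by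
    ext x
    rw [LinearMap.mem_ker, hf, Ideal.Quotient.eq_zero_iff_mem, Ideal.mem_span_singleton,
      Ideal.mem_span_singleton, mul_comm d, mul_dvd_mul_iff_left hq]
  have hrange : f.range = Submodule.torsionBy K[X] (K[X] ⧸ Ideal.span {d * q}) (d * p) := by
    ext y
    obtain ⟨y, rfl⟩ := Ideal.Quotient.mk_surjective y
    rw [Submodule.mem_torsionBy_iff]
    change _ ↔ Ideal.Quotient.mk (Ideal.span {d * q}) (d * p * y) = 0
    rw [Ideal.Quotient.eq_zero_iff_mem, Ideal.mem_span_singleton,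
      mul_assoc, mul_dvd_mul_iff_left hd,
      show q ∣ p * y ↔ q ∣ y from ⟨hpq.symm.dvd_of_dvd_mul_left, fun h => h.mul_left p⟩]
    constructor
    · rintro ⟨x, hx⟩
      rw [hf, Ideal.Quotient.eq, Ideal.mem_span_singleton] at hx
      exact (dvd_sub_right (dvd_mul_right q x)).1 ((dvd_mul_left q d).trans hx)
    · rintro ⟨x, rfl⟩
      exact ⟨x, rfl⟩
  rw [← finrank_quotient_span_eq_natDegree]
  exact (((Submodule.quotEquivOfEq _ _ hker.symm).trans (f.quotKerEquivRange.trans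
    (LinearEquiv.ofEq _ _ hrange))).restrictScalars K).finrank_eq.symm

open Classical in
lemma finrank_torsionBy_primary (a b : K) (e k : ℕ) :
    Module.finrank K (Submodule.torsionBy K[X] (K[X] ⧸ Ideal.span {(X - C a) ^ e})
      ((X - C b) ^ k)) = if a = b then min k e else 0 := by
  have hX (m : ℕ) : (X - C a : K[X]) ^ m ≠ 0 := pow_ne_zero _ (X_sub_C_ne_zero a)
  split_ifs with hab
  · subst hab
    have h := finrank_torsionBy_quotient_span (K := K) (d := (X - C a) ^ min k e)
      (p := (X - C a) ^ (k - e)) (q := (X - C a) ^ (e - k)) ?_ (hX _) (hX _)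
    · rwa [← pow_add, ← pow_add, natDegree_pow, natDegree_X_sub_C, mul_one,
        show min k e + (e - k) = e by omega, show min k e + (k - e) = k by omega] at h
    · rcases le_total k e with h | h
      · simp [Nat.sub_eq_zero_of_le h, isCoprime_one_left]
      · simp [Nat.sub_eq_zero_of_le h, isCoprime_one_right]
  · have h := finrank_torsionBy_quotient_span (K := K) (d := 1)
      (p := (X - C b) ^ k) (q := (X - C a) ^ e) ?_ one_ne_zero (hX _)
    · rwa [one_mul, one_mul, natDegree_one] at h
    · exact (isCoprime_X_sub_C_of_isUnit_sub (sub_ne_zero.2 (Ne.symm hab)).isUnit).pow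

lemma exists_equiv_pi_quotient_span_X_sub_C_pow [IsAlgClosed K] {M : Type*} [AddCommGroup M]
    [Module K[X] M] [Module.Finite K[X] M] (hM : Module.IsTorsion K[X] M) :
    ∃ (ι : Type u) (_ : Fintype ι) (a : ι → K) (e : ι → ℕ), (∀ i, e i ≠ 0) ∧
      Nonempty (M ≃ₗ[K[X]] ∀ i, K[X] ⧸ Ideal.span {(X - C (a i)) ^ e i}) := by
  classical
  obtain ⟨ι, _, p, hp, e, ⟨f⟩⟩ := Module.equiv_directSum_of_isTorsion hM
  have hroot (i) : ∃ a, (p i).IsRoot a :=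
    IsAlgClosed.exists_root _ (hp i).degree_pos.ne'
  choose a ha using hroot
  have hassoc (i) : Associated (p i) (X - C (a i)) :=
    ((irreducible_X_sub_C (a i)).associated_of_dvd (hp i) (dvd_iff_isRoot.2 (ha i))).symm
  have hspan (i) : Submodule.span K[X] {p i ^ e i} = Ideal.span {(X - C (a i)) ^ e i} :=
    Ideal.span_singleton_eq_span_singleton.2 ((hassoc i).pow_pow)
  let N (i : ι) := K[X] ⧸ Ideal.span {(X - C (a i)) ^ e i}
  let g : (∀ i, N i) →ₗ[K[X]] ∀ i : {i // e i ≠ 0}, N i :=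
    LinearMap.pi fun i => LinearMap.proj i.1
  have hsub (i) (hi : e i = 0) : Subsingleton (N i) :=
    Ideal.Quotient.subsingleton_iff.2 (by simp [hi])
  have hg : Function.Bijective g := by
    refine ⟨fun x y hxy => funext fun i => ?_, fun y => ?_⟩
    · by_cases hi : e i = 0
      · exact (hsub i hi).elim _ _
      · exact congrFun hxy ⟨i, hi⟩
    · exact ⟨fun i => if hi : e i ≠ 0 then y ⟨i, hi⟩ else 0, funext fun i => dif_pos i.2⟩
  exact ⟨{i // e i ≠ 0}, inferInstance, fun i => a i, fun i => e i, fun i => i.2,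
    ⟨f.trans <| (DirectSum.linearEquivFunOnFintype _ _ _).trans <|
      (LinearEquiv.piCongrRight fun i => Submodule.quotEquivOfEq _ _ (hspan i)).trans <|
        LinearEquiv.ofBijective g hg⟩⟩

open Classical in
lemma finrank_torsionBy_of_equiv_pi {M ι : Type*} [AddCommGroup M] [Module K M]
    [Module K[X] M] [IsScalarTower K K[X] M] [Fintype ι] {a : ι → K} {e : ι → ℕ}
    (f : M ≃ₗ[K[X]] ∀ i, K[X] ⧸ Ideal.span {(X - C (a i)) ^ e i}) (b : K) (k : ℕ) :
    Module.finrank K (Submodule.torsionBy K[X] M ((X - C b) ^ k)) =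
      ∑ i, if a i = b then min k (e i) else 0 := by
  have hfin (i) : FiniteDimensional K (K[X] ⧸ Ideal.span {(X - C (a i)) ^ e i}) :=
    ((monic_X_sub_C (a i)).pow (e i)).finite_quotient
  rw [finrank_torsionBy_congr f, finrank_torsionBy_pi]
  exact Finset.sum_congr rfl fun i _ => finrank_torsionBy_primary _ _ _ _

open Classical in
lemma card_fiber_eq_second_difference {ι α : Type*} [Fintype ι] (a : ι → α) (e : ι → ℕ) (b : α)
    (m : ℕ) :
    (Fintype.card {i // (a i, e i) = (b, m + 1)} : ℤ) =
      2 * ((∑ i, if a i = b then min (m + 1) (e i) else 0 : ℕ) : ℤ) -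
        ((∑ i, if a i = b then min m (e i) else 0 : ℕ) : ℤ) -
        ((∑ i, if a i = b then min (m + 2) (e i) else 0 : ℕ) : ℤ) := by
  rw [Fintype.card_subtype, Finset.card_filter, Nat.cast_sum, Nat.cast_sum, Nat.cast_sum,
    Nat.cast_sum, Finset.mul_sum,
    ← Finset.sum_sub_distrib, ← Finset.sum_sub_distrib]
  refine Finset.sum_congr rfl fun i _ => ?_
  simp only [Prod.mk.injEq]
  by_cases hab : a i = b
  · simp only [hab, true_and, if_true]
    split_ifs <;> omega
  · simp [hab]

/-- A finitely generated torsion `K[X]`-module over an algebraically closed field `K` is determined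
up to isomorphism by the dimensions of the kernels of the powers of `X - b`. -/
theorem nonempty_linearEquiv_of_finrank_torsionBy_eq [IsAlgClosed K] {M N : Type*}
    [AddCommGroup M] [AddCommGroup N] [Module K M] [Module K N] [Module K[X] M] [Module K[X] N]
    [IsScalarTower K K[X] M] [IsScalarTower K K[X] N] [Module.Finite K[X] M]
    [Module.Finite K[X] N] (hM : Module.IsTorsion K[X] M) (hN : Module.IsTorsion K[X] N)
    (h : ∀ (b : K) (k : ℕ), Module.finrank K (Submodule.torsionBy K[X] M ((X - C b) ^ k)) =
      Module.finrank K (Submodule.torsionBy K[X] N ((X - C b) ^ k))) :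
    Nonempty (M ≃ₗ[K[X]] N) := by
  classical
  obtain ⟨ι, _, a, e, he, ⟨f⟩⟩ := exists_equiv_pi_quotient_span_X_sub_C_pow hM
  obtain ⟨κ, _, a', e', he', ⟨f'⟩⟩ := exists_equiv_pi_quotient_span_X_sub_C_pow hN
  have hsum (b : K) (k : ℕ) : (∑ i, if a i = b then min k (e i) else 0) =
      ∑ j, if a' j = b then min k (e' j) else 0 := by
    rw [← finrank_torsionBy_of_equiv_pi f, ← finrank_torsionBy_of_equiv_pi f', h]
  have hcard (c : K × ℕ) : Nonempty ({i // (a i, e i) = c} ≃ {j // (a' j, e' j) = c}) := by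
    obtain ⟨b, _ | m⟩ := c
    · have : IsEmpty {i // (a i, e i) = (b, 0)} := ⟨fun i => he i.1 (congrArg Prod.snd i.2)⟩
      have : IsEmpty {i // (a' i, e' i) = (b, 0)} := ⟨fun i => he' i.1 (congrArg Prod.snd i.2)⟩
      exact ⟨Equiv.equivOfIsEmpty _ _⟩
    · rw [← Fintype.card_eq, ← Nat.cast_inj (R := ℤ), card_fiber_eq_second_difference,
        card_fiber_eq_second_difference, hsum, hsum, hsum]
  let σ : ι ≃ κ := Equiv.ofFiberEquiv (f := fun i => (a i, e i))
    (g := fun j => (a' j, e' j)) fun c => (hcard c).some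
  have hσ (i) : (a' (σ i), e' (σ i)) = (a i, e i) :=
    Equiv.ofFiberEquiv_map (f := fun i => (a i, e i)) (g := fun j => (a' j, e' j)) _ i
  have hspan (i) : Ideal.span {(X - C (a i)) ^ e i} =
      Ideal.span {(X - C (a' (σ i))) ^ e' (σ i)} := by
    rw [(Prod.mk.inj (hσ i)).1, (Prod.mk.inj (hσ i)).2]
  exact ⟨f.trans <|
    (LinearEquiv.piCongrRight fun i => Submodule.quotEquivOfEq _ _ (hspan i)).trans <|
      (LinearEquiv.piCongrLeft K[X]
        (fun j => K[X] ⧸ Ideal.span {(X - C (a' j)) ^ e' j}) σ).trans f'.symm⟩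

open Module

lemma finrank_torsionBy_AEval' {V : Type*} [AddCommGroup V] [Module K V] (f : End K V) (b : K)
    (k : ℕ) :
    finrank K (Submodule.torsionBy K[X] (AEval' f) ((X - C b) ^ k)) =
      finrank K ((f - algebraMap K (End K V) b) ^ k).ker := by
  let e : ((f - algebraMap K (End K V) b) ^ k).ker ≃ₗ[K]
      (Submodule.torsionBy K[X] (AEval' f) ((X - C b) ^ k)).restrictScalars K :=
    (AEval'.of f).ofSubmodules _ _ <| by
      ext x
      obtain ⟨x, rfl⟩ := (AEval'.of f).surjective x
      rw [Submodule.restrictScalars_mem, Submodule.mem_torsionBy_iff, ← AEval.of_aeval_smul]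
      simp
  exact e.finrank_eq.symm

theorem exists_conj_of_finrank_ker_pow_eq [IsAlgClosed K] {V : Type*} [AddCommGroup V] [Module K V]
    [FiniteDimensional K V] (f g : End K V)
    (h : ∀ (b : K) (k : ℕ), finrank K ((f - algebraMap K (End K V) b) ^ k).ker =
      finrank K ((g - algebraMap K (End K V) b) ^ k).ker) :
    ∃ e : V ≃ₗ[K] V, ∀ v, e (f v) = g (e v) := by
  obtain ⟨e⟩ := nonempty_linearEquiv_of_finrank_torsionBy_eq (M := AEval' f) (N := AEval' g)
    (AEval.isTorsion_of_finiteDimensional K V f) (AEval.isTorsion_of_finiteDimensional K V g)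
    fun b k => by rw [finrank_torsionBy_AEval', finrank_torsionBy_AEval', h]
  refine ⟨(AEval'.of f).trans ((e.restrictScalars K).trans (AEval'.of g).symm), fun v => ?_⟩
  apply (AEval'.of g).injective
  simp [← AEval'.X_smul_of]

end

open Matrix in
/-- Square matrices over an algebraically closed field are similar if all powers of their shifts
by scalars have the same rank. -/
theorem exists_conj_of_rank_pow_eq {K ι : Type*} [Field K] [IsAlgClosed K] [Fintype ι]
    [DecidableEq ι] (A B : Matrix ι ι K)
    (h : ∀ (b : K) (k : ℕ), ((A - b • 1) ^ k).rank = ((B - b • 1) ^ k).rank) :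
    ∃ P : GL ι K, P * A = B * P := by
  have hker (A : Matrix ι ι K) (b : K) (k : ℕ) : ((A - b • 1) ^ k).rank +
      Module.finrank K ((toLin' A - algebraMap K (Module.End K (ι → K)) b) ^ k).ker =
        Fintype.card ι := by
    have hlin : toLin' ((A - b • 1) ^ k) =
        (toLin' A - algebraMap K (Module.End K (ι → K)) b) ^ k := by
      rw [toLin'_pow, map_sub, map_smul, toLin'_one, Algebra.algebraMap_eq_smul_one]
      rfl
    rw [← hlin, rank, ← toLin'_apply', LinearMap.finrank_range_add_finrank_ker,
      Module.finrank_fintype_fun_eq_card]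
  obtain ⟨e, he⟩ := exists_conj_of_finrank_ker_pow_eq (toLin' A) (toLin' B) fun b k => by
    have hA := hker A b k
    have hB := hker B b k
    have := h b k
    omega
  let P : GL ι K := ⟨LinearMap.toMatrix' e, LinearMap.toMatrix' e.symm,
    by rw [← LinearMap.toMatrix'_comp]; simp, by rw [← LinearMap.toMatrix'_comp]; simp⟩
  refine ⟨P, ?_⟩
  apply toLin'.injective
  rw [toLin'_mul, toLin'_mul]
  refine LinearMap.ext fun v => ?_
  simpa [P] using he v

section
open Matrix
variable {n : ℕ}

lemma rank_inv_sub_smul_pow (A : GL (Fin n) ℂ) {lam : ℂ} (hlam : lam ≠ 0) (k : ℕ) :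
    (((A⁻¹ : GL (Fin n) ℂ) - lam • 1 : Matrix (Fin n) (Fin n) ℂ) ^ k).rank =
      (((A : Matrix (Fin n) (Fin n) ℂ) - lam⁻¹ • 1) ^ k).rank := by
  set M : Matrix (Fin n) (Fin n) ℂ := A.val
  set N : Matrix (Fin n) (Fin n) ℂ := (A⁻¹ : GL (Fin n) ℂ).val
  have hNM : N * M = 1 := A.inv_mul
  have hMN : M * N = 1 := A.mul_inv
  have hfac : N - lam • 1 = ((-lam) • N) * (M - lam⁻¹ • 1) := by
    rw [mul_sub, smul_mul_assoc, hNM, mul_smul_comm, mul_one, smul_smul, mul_neg,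
      inv_mul_cancel₀ hlam, neg_smul, neg_smul, one_smul]
    abel
  have hcomm : Commute ((-lam) • N) (M - lam⁻¹ • 1) :=
    ((show Commute N M from hNM.trans hMN.symm).sub_right
      ((Commute.one_right N).smul_right _)).smul_left _
  have hunit : IsUnit ((-lam) • N) :=
    IsUnit.of_mul_eq_one ((-lam)⁻¹ • M) (by simp [hNM, hlam, smul_smul])
  rw [hfac, hcomm.mul_pow,
    rank_mul_eq_right_of_isUnit_det _ _ ((isUnit_iff_isUnit_det _).1 (hunit.pow k))]

lemma rank_pow_succ_le (M : Matrix (Fin n) (Fin n) ℂ) (k : ℕ) :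
    (M ^ (k + 1)).rank ≤ (M ^ k).rank := by
  rw [pow_succ]
  exact rank_mul_le_left _ _

end

lemma eq_of_second_difference_eq {r s : ℕ → ℕ} (hr : Antitone r) (hs : Antitone s)
    (h0 : r 0 = s 0)
    (h : ∀ m, (r m : ℤ) - 2 * r (m + 1) + r (m + 2) = s m - 2 * s (m + 1) + s (m + 2)) (k : ℕ) :
    r k = s k := by
  have hlin (k : ℕ) : (r k : ℤ) - s k = k * ((r 1 : ℤ) - s 1) := by
    induction k using Nat.twoStepInduction with
    | zero => simp [h0]
    | one => simp
    | more k h1 h2 =>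
      have := h k
      push_cast at h1 h2 ⊢
      linarith
  have hbound := hlin (r 0 + 1)
  have h1 := hr (Nat.zero_le (r 0 + 1))
  have h2 := hs (Nat.zero_le (r 0 + 1))
  have hzero : (r 1 : ℤ) - s 1 = 0 := by
    push_cast at hbound
    by_contra hne
    rcases lt_or_gt_of_ne hne with hlt | hlt <;> nlinarith
  have := hlin k
  rw [hzero, mul_zero] at this
  omega

/-- A matrix `A ∈ GL(n, ℂ)` is conjugate to its inverse if and only if for each eigenvalue
`lam ≠ ±1` and each block size, the number of Jordan blocks of `A` of that size with
eigenvalue `lam` equals the number of Jordan blocks of the same size with eigenvalue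
`lam⁻¹`. -/
theorem conjugate_to_inverse_iff_jordan_counts (n : ℕ) (A : GL (Fin n) ℂ) :
    (∃ P : GL (Fin n) ℂ, P⁻¹ * A * P = A⁻¹) ↔
      ∀ lam : ℂ, lam ≠ 1 → lam ≠ -1 → ∀ m : ℕ,
        jordanBlockCount (A : Matrix (Fin n) (Fin n) ℂ) lam m =
          jordanBlockCount (A : Matrix (Fin n) (Fin n) ℂ) lam⁻¹ m := by
  constructor
  · rintro ⟨P, hP⟩ lam - - m
    rcases eq_or_ne lam 0 with rfl | hlam
    · rw [inv_zero]
    have hrank (k : ℕ) : (((A : Matrix (Fin n) (Fin n) ℂ) - lam • 1) ^ k).rank =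
        (((A : Matrix (Fin n) (Fin n) ℂ) - lam⁻¹ • 1) ^ k).rank := by
      have hconj : ((A⁻¹ : GL (Fin n) ℂ) - lam • 1 : Matrix (Fin n) (Fin n) ℂ) =
          (P⁻¹ : GL (Fin n) ℂ) * ((A : Matrix (Fin n) (Fin n) ℂ) - lam • 1) * P := by
        rw [← hP, mul_sub, sub_mul]
        simp
      rw [← rank_inv_sub_smul_pow A hlam, hconj, Units.conj_pow',
        Matrix.rank_mul_eq_left_of_isUnit_det _ _ ((Matrix.isUnit_iff_isUnit_det _).1 P.isUnit),
        Matrix.rank_mul_eq_right_of_isUnit_det _ _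
          ((Matrix.isUnit_iff_isUnit_det _).1 P⁻¹.isUnit)]
    simp only [jordanBlockCount, hrank]
  · intro h
    obtain ⟨P, hP⟩ := exists_conj_of_rank_pow_eq
      (A⁻¹ : GL (Fin n) ℂ).val (A : Matrix (Fin n) (Fin n) ℂ) fun lam k => by
        rcases eq_or_ne lam 0 with rfl | hlam
        · rw [zero_smul, sub_zero, sub_zero, Matrix.rank_of_isUnit _ ((Units.isUnit _).pow k),
            Matrix.rank_of_isUnit _ ((Units.isUnit _).pow k)]
        · rw [rank_inv_sub_smul_pow A hlam]
          by_cases h1 : lam = 1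
          · simp [h1]
          by_cases h2 : lam = -1
          · norm_num [h2]
          exact eq_of_second_difference_eq (antitone_nat_of_succ_le (rank_pow_succ_le _))
            (antitone_nat_of_succ_le (rank_pow_succ_le _)) (by simp)
            (fun m => (h lam h1 h2 m).symm) k
    have hP' : P * A⁻¹ = A * P := Units.ext hP
    exact ⟨P, by rw [mul_assoc, ← hP', inv_mul_cancel_left]⟩
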